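/- arXiv:2205.00233 — 3 statements merged into one kernel-verified Lean document; each statement's English description precedes it below -/
import Mathlib

section
/- Let K and t be positive integers with t ≤ K. Define the array Q, with rows indexed by the t-element subsets T of [K] and columns indexed by k ∈ [K], by Q(T,k) = T ∪ {k} (regarded as an element of the (t+1)-element subsets of [K]) if k ∉ T, and Q(T,k) = * if k ∈ T. Then Q is a (K, C(K,t), C(K−1,t−1), C(K,t+1)) PDA: (C1) each column contains exactly C(K−1,t−1) stars; (C2) every (t+1)-element subset of [K] occurs as an entry of Q; (C3) whenever two distinct entries Q(T₁,k₁) and Q(T₂,k₂) are equal to the same (t+1)-element subset, then T₁ ≠ T₂, k₁ ≠ k₂, and Q(T₁,k₂) = Q(T₂,k₁) = *. -/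
/-- The number of `t`-element subsets of a finite type containing a given element. -/
theorem card_filter_card_eq_and_mem {α : Type*} [Fintype α] [DecidableEq α] {t : ℕ}
    (ht : 0 < t) (a : α) :
    (Finset.univ.filter fun T : Finset α => T.card = t ∧ a ∈ T).card
      = (Fintype.card α - 1).choose (t - 1) := by
  rw [← Finset.card_univ, ← Finset.card_erase_of_mem (Finset.mem_univ a),
    ← Finset.card_powersetCard]
  refine Finset.card_nbij' (fun T => T.erase a) (fun T => insert a T) ?_ ?_ ?_ ?_
  · intro T hT
    obtain ⟨hcard, ha⟩ : T.card = t ∧ a ∈ T := by simpa using hT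
    simp only [Finset.mem_coe, Finset.mem_powersetCard]
    exact ⟨Finset.erase_subset_erase a (Finset.subset_univ T),
      by rw [Finset.card_erase_of_mem ha, hcard]⟩
  · intro T hT
    simp only [Finset.mem_coe, Finset.mem_powersetCard] at hT
    have ha : a ∉ T := fun h => Finset.notMem_erase a _ (hT.1 h)
    simp only [Finset.coe_filter, Finset.mem_univ, true_and, Set.mem_ofPred_eq]
    exact ⟨by rw [Finset.card_insert_of_notMem ha]; omega, Finset.mem_insert_self a T⟩
  · intro T hT
    have ha : T.card = t ∧ a ∈ T := by simpa using hT
    exact Finset.insert_erase ha.2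
  · intro T hT
    simp only [Finset.mem_coe, Finset.mem_powersetCard] at hT
    exact Finset.erase_insert fun h => Finset.notMem_erase a _ (hT.1 h)

/-- Let `K` and `t` be positive integers with `t ≤ K`. The MN array `Q`,
with rows indexed by the `t`-element subsets `T` of `[K]` and columns by `k ∈ [K]`, defined by
`Q(T,k) = T ∪ {k}` if `k ∉ T` and `Q(T,k) = *` (here `none`) if `k ∈ T`, is a
`(K, C(K,t), C(K−1,t−1), C(K,t+1))` PDA whose integer alphabet is the set of
`(t+1)`-element subsets of `[K]`. -/
theorem mn_pda_is_pda (K t : ℕ) (hK : 0 < K) (ht : 0 < t) (htK : t ≤ K)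
    (Q : Finset (Fin K) → Fin K → Option (Finset (Fin K)))
    (hQ : ∀ (T : Finset (Fin K)) (k : Fin K),
      Q T k = if k ∈ T then none else some (insert k T)) :
    -- the number of rows is C(K,t)
    ((Finset.univ.filter fun T : Finset (Fin K) => T.card = t).card = K.choose t) ∧
    -- every integer entry belongs to the alphabet of (t+1)-element subsets of [K]
    (∀ (T : Finset (Fin K)) (k : Fin K) (S : Finset (Fin K)),
      T.card = t → Q T k = some S → S.card = t + 1) ∧
    -- C1: each column contains exactly C(K−1,t−1) stars
    (∀ k : Fin K,
      (Finset.univ.filter fun T : Finset (Fin K) => T.card = t ∧ Q T k = none).card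
        = (K - 1).choose (t - 1)) ∧
    -- C2: every (t+1)-element subset of [K] occurs as an entry of Q
    (∀ S : Finset (Fin K), S.card = t + 1 →
      ∃ (T : Finset (Fin K)) (k : Fin K), T.card = t ∧ Q T k = some S) ∧
    -- C3: equal integer entries lie in distinct rows and columns, with stars at the
    -- other two corners of the corresponding 2×2 subarray
    (∀ (T₁ T₂ : Finset (Fin K)) (k₁ k₂ : Fin K) (S : Finset (Fin K)),
      T₁.card = t → T₂.card = t → (T₁, k₁) ≠ (T₂, k₂) →
      Q T₁ k₁ = some S → Q T₂ k₂ = some S →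
      T₁ ≠ T₂ ∧ k₁ ≠ k₂ ∧ Q T₁ k₂ = none ∧ Q T₂ k₁ = none) := by
  have hnone (T : Finset (Fin K)) (k : Fin K) : Q T k = none ↔ k ∈ T := by simp [hQ]
  have hsome (T : Finset (Fin K)) (k : Fin K) (S : Finset (Fin K)) :
      Q T k = some S ↔ k ∉ T ∧ insert k T = S := by simp [hQ]
  simp only [hnone, hsome]
  refine ⟨?_, ?_, ?_, ?_, ?_⟩
  · rw [← Finset.powerset_univ, ← Finset.powersetCard_eq_filter]
    simp
  · rintro T k S hT ⟨hk, rfl⟩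
    rw [Finset.card_insert_of_notMem hk, hT]
  · intro k
    simpa using card_filter_card_eq_and_mem ht k
  · intro S hS
    obtain ⟨k, hk⟩ : S.Nonempty := Finset.card_pos.mp (by omega)
    exact ⟨S.erase k, k, by rw [Finset.card_erase_of_mem hk, hS, Nat.add_sub_cancel],
      Finset.notMem_erase k S, Finset.insert_erase hk⟩
  · rintro T₁ T₂ k₁ k₂ S - - hne ⟨hk₁, rfl⟩ ⟨hk₂, hS⟩
    have hk : k₁ ≠ k₂ := by
      rintro rfl
      apply hne
      rw [← Finset.erase_insert hk₁, ← hS, Finset.erase_insert hk₂]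
    have h₁ : k₂ ∈ T₁ := Finset.mem_of_mem_insert_of_ne
      (hS ▸ Finset.mem_insert_self k₂ T₂) hk.symm
    have h₂ : k₁ ∈ T₂ := Finset.mem_of_mem_insert_of_ne
      (hS ▸ Finset.mem_insert_self k₁ T₁) hk
    exact ⟨fun h => hk₁ (h ▸ h₂), hk, h₁, h₂⟩
end

section
/- For all positive integers K₁, K₂ and t with K₂ < t < K₁K₂, setting K = K₁K₂, there exist finite sets of natural numbers S_m and S_1,…,S_{K₁} and arrays P⁽⁰⁾, P⁽¹⁾,…,P⁽ᴷ¹⁾ forming a (K₁, K₂; C(K,t); C(K−K₂, t−K₂), C(K−1,t−1) − C(K−K₂, t−K₂); S_m, S_1,…,S_{K₁}) HPDA, such that moreover S_m ⊆ ⋃_{k₁∈[K₁]} S_{k₁}, the cardinality |⋃_{k₁∈[K₁]} S_{k₁}| − |S_m| equals C(K, t+1), and for every k₁ ∈ [K₁] the cardinality |S_{k₁}| equals K₂·C(K−K₂, t−K₂) + C(K, t+1) − C(K−K₂, t+1). -/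
/-- A `(K, F, Z, |S|)` placement delivery array with integer alphabet the finite set
`S ⊆ ℕ`: an `F × K` array with entries in `{*} ∪ S` (a star is modeled by `none`)
satisfying conditions C1, C2, C3. -/
def IsPDA (K F : ℕ) (S : Finset ℕ) (Z : ℕ) (P : Fin F → Fin K → Option ℕ) : Prop :=
  -- entries are drawn from {*} ∪ S
  (∀ (j : Fin F) (k : Fin K) (s : ℕ), P j k = some s → s ∈ S) ∧
  -- C1: each column contains exactly Z stars
  (∀ k : Fin K, (Finset.univ.filter fun j : Fin F => P j k = none).card = Z) ∧
  -- C2: every integer of S occurs at least once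
  (∀ s ∈ S, ∃ (j : Fin F) (k : Fin K), P j k = some s) ∧
  -- C3
  (∀ (j₁ j₂ : Fin F) (k₁ k₂ : Fin K) (s : ℕ),
    P j₁ k₁ = some s → P j₂ k₂ = some s → (j₁, k₁) ≠ (j₂, k₂) →
    j₁ ≠ j₂ ∧ k₁ ≠ k₂ ∧ P j₁ k₂ = none ∧ P j₂ k₁ = none)

/-- A `(K₁, K₂; F; Z₁, Z₂; S_m, S_1, …, S_{K₁})` hierarchical placement delivery array:
`P0` is the `F × K₁` mirror-placement array (entry `true` = star, `false` = null) and
`P k₁` is the `F × K₂` array of the users attached to mirror `k₁`, with integer alphabet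
`Sk k₁`, satisfying conditions B1–B4. -/
def IsHPDA (K₁ K₂ F Z₁ Z₂ : ℕ) (Sm : Finset ℕ) (Sk : Fin K₁ → Finset ℕ)
    (P0 : Fin F → Fin K₁ → Bool) (P : Fin K₁ → Fin F → Fin K₂ → Option ℕ) : Prop :=
  Z₁ < F ∧ Z₂ < F ∧
  -- B1: each column of P0 contains exactly Z₁ stars
  (∀ k₁ : Fin K₁, (Finset.univ.filter fun j : Fin F => P0 j k₁ = true).card = Z₁) ∧
  -- B2: each P^{(k₁)} is a (K₂, F, Z₂, |Sk k₁|) PDA with alphabet Sk k₁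
  (∀ k₁ : Fin K₁, IsPDA K₂ F (Sk k₁) Z₂ (P k₁)) ∧
  -- B3: each s ∈ Sm occurs in exactly one subarray P^{(k₁)} …
  (∀ s ∈ Sm, ∃! k₁ : Fin K₁, ∃ (j : Fin F) (k₂ : Fin K₂), P k₁ j k₂ = some s) ∧
  -- … and wherever P^{(k₁)}(j,k₂) = s ∈ Sm, the mirror has a star: P0(j,k₁) = *
  (∀ (k₁ : Fin K₁) (j : Fin F) (k₂ : Fin K₂) (s : ℕ),
    P k₁ j k₂ = some s → s ∈ Sm → P0 j k₁ = true) ∧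
  -- B4
  (∀ (k₁ k₁' : Fin K₁) (j j' : Fin F) (k₂ k₂' : Fin K₂) (s : ℕ), k₁ ≠ k₁' →
    P k₁ j k₂ = some s → P k₁' j' k₂' = some s →
    ((∃ s' : ℕ, P k₁ j' k₂ = some s') → P0 j' k₁ = true) ∧
    ((∃ s' : ℕ, P k₁' j k₂' = some s') → P0 j k₁' = true))

open Finset in
/-- The `n`-subsets of a finite type that contain a given set `B` of size at most `n`. -/
lemma card_filter_superset_powersetCard {α : Type*} [Fintype α] [DecidableEq α] (B : Finset α)
    {n : ℕ} (hB : #B ≤ n) :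
    #{T ∈ powersetCard n univ | B ⊆ T} = (Fintype.card α - #B).choose (n - #B) := by
  rw [← card_compl, ← card_powersetCard]
  refine card_nbij' (· \ B) (· ∪ B) ?_ ?_ ?_ ?_
  · intro T hT
    simp only [mem_coe, mem_filter, mem_powersetCard, subset_univ, true_and] at hT
    simp only [mem_coe, mem_powersetCard]
    exact ⟨fun x hx => by simp_all, by rw [card_sdiff_of_subset hT.2, hT.1]⟩
  · intro T hT
    simp only [mem_coe, mem_powersetCard] at hT
    have hd : Disjoint T B := by
      rw [← subset_compl_iff_disjoint_right]; exact hT.1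
    simp only [mem_coe, mem_filter, mem_powersetCard, subset_univ, true_and]
    refine ⟨?_, subset_union_right⟩
    rw [card_union_of_disjoint hd, hT.2]; omega
  · intro T hT
    simp only [mem_coe, mem_filter] at hT
    exact sdiff_union_of_subset hT.2
  · intro T hT
    simp only [mem_coe, mem_powersetCard] at hT
    have hd : Disjoint T B := by
      rw [← subset_compl_iff_disjoint_right]; exact hT.1
    exact union_sdiff_cancel_right hd

open Finset in
/-- The `n`-subsets of a finite type that meet a given set `B`. -/
lemma card_filter_not_disjoint_powersetCard {α : Type*} [Fintype α] [DecidableEq α]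
    (B : Finset α) (n : ℕ) :
    #{T ∈ powersetCard n univ | ¬ Disjoint T B} =
      (Fintype.card α).choose n - (Fintype.card α - #B).choose n := by
  have h := card_filter_add_card_filter_not (s := powersetCard n (univ : Finset α))
    (fun T => Disjoint T B)
  have h' : {T ∈ powersetCard n (univ : Finset α) | Disjoint T B} = powersetCard n Bᶜ := by
    ext T
    simp [mem_powersetCard, subset_compl_iff_disjoint_right, and_comm]
  rw [h', card_powersetCard, card_powersetCard, card_compl, card_univ] at h
  omega

namespace HPDA

variable {K₁ K₂ : ℕ}

/-- The users attached to mirror `k₁`. -/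
def block (K₂ : ℕ) (k₁ : Fin K₁) : Finset (Fin K₁ × Fin K₂) := {k₁} ×ˢ Finset.univ

lemma mem_block {k₁ : Fin K₁} {u : Fin K₁ × Fin K₂} : u ∈ block K₂ k₁ ↔ u.1 = k₁ := by
  rw [block, Finset.mem_product, Finset.mem_singleton]
  simp

lemma card_block (k₁ : Fin K₁) : (block K₂ k₁).card = K₂ := by
  simp [block]

/-- Symbols: either a set of users (shared by its members) or a pair (row, user) occurring once. -/
abbrev Symb (K₁ K₂ : ℕ) : Type :=
  Finset (Fin K₁ × Fin K₂) ⊕ (Finset (Fin K₁ × Fin K₂) × (Fin K₁ × Fin K₂))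

/-- Entry of the array in row `T` and the column of user `u`: the Maddah-Ali–Niesen symbol
`T ∪ {u}` if `u ∉ T`, and otherwise a star, replaced by a fresh symbol if `T` contains
the whole block of `u`. -/
def cell (T : Finset (Fin K₁ × Fin K₂)) (u : Fin K₁ × Fin K₂) : Option (Symb K₁ K₂) :=
  if u ∉ T then some (.inl (insert u T))
  else if block K₂ u.1 ⊆ T then some (.inr (T, u)) else none

lemma cell_eq_inl {T A : Finset (Fin K₁ × Fin K₂)} {u : Fin K₁ × Fin K₂} :
    cell T u = some (.inl A) ↔ u ∉ T ∧ insert u T = A := by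
  unfold cell; split_ifs <;> simp_all

lemma cell_eq_inr {T : Finset (Fin K₁ × Fin K₂)} {u : Fin K₁ × Fin K₂}
    {p : Finset (Fin K₁ × Fin K₂) × (Fin K₁ × Fin K₂)} :
    cell T u = some (.inr p) ↔ block K₂ u.1 ⊆ T ∧ (T, u) = p := by
  have : block K₂ u.1 ⊆ T → u ∈ T := fun h => h (mem_block.2 rfl)
  unfold cell; split_ifs <;> simp_all

lemma cell_eq_none {T : Finset (Fin K₁ × Fin K₂)} {u : Fin K₁ × Fin K₂} :
    cell T u = none ↔ u ∈ T ∧ ¬ block K₂ u.1 ⊆ T := by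
  unfold cell; split_ifs <;> simp_all

/-- Two different occurrences of a symbol are occurrences of a set of users. -/
lemma mem_of_cell_eq {T T' : Finset (Fin K₁ × Fin K₂)} {u u' : Fin K₁ × Fin K₂}
    {s : Symb K₁ K₂} (h : cell T u = some s) (h' : cell T' u' = some s)
    (hne : (T, u) ≠ (T', u')) : u ∉ T ∧ u' ∉ T' ∧ u ∈ T' ∧ u' ∈ T ∧ T ≠ T' ∧ u ≠ u' := by
  rcases s with A | p
  · rw [cell_eq_inl] at h h'
    obtain ⟨hu, hA⟩ := h
    obtain ⟨hu', hA'⟩ := h'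
    have huu : u ≠ u' := by
      rintro rfl
      refine hne (Prod.ext ?_ rfl)
      show T = T'
      rw [← Finset.erase_insert hu, hA, ← hA', Finset.erase_insert hu']
    have h1 : u ∈ T' := by
      have : u ∈ insert u' T' := by rw [hA', ← hA]; exact Finset.mem_insert_self _ _
      exact (Finset.mem_insert.1 this).resolve_left huu
    have h2 : u' ∈ T := by
      have : u' ∈ insert u T := by rw [hA, ← hA']; exact Finset.mem_insert_self _ _
      exact (Finset.mem_insert.1 this).resolve_left huu.symm
    exact ⟨hu, hu', h1, h2, fun e => hu (e ▸ h1), huu⟩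
  · rw [cell_eq_inr] at h h'
    exact absurd (h.2.trans h'.2.symm) hne

/-- The symbols that occur in the array of mirror `k₁`. -/
def symbols (t : ℕ) (k₁ : Fin K₁) : Finset (Symb K₁ K₂) :=
  ((Finset.powersetCard (t + 1) Finset.univ).filter fun A => ¬ Disjoint A (block K₂ k₁)).disjSum
    (((Finset.powersetCard t Finset.univ).filter fun T => block K₂ k₁ ⊆ T) ×ˢ block K₂ k₁)

/-- The symbols served by the mirrors alone. -/
def mirrorSymbols (K₁ K₂ t : ℕ) : Finset (Symb K₁ K₂) :=
  (∅ : Finset (Finset (Fin K₁ × Fin K₂))).disjSum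
    ((Finset.powersetCard t Finset.univ ×ˢ Finset.univ).filter fun p => block K₂ p.2.1 ⊆ p.1)

lemma mem_symbols {t : ℕ} {k₁ : Fin K₁} {s : Symb K₁ K₂} :
    s ∈ symbols t k₁ ↔ ∃ T : Finset (Fin K₁ × Fin K₂), T.card = t ∧
      ∃ k₂, cell T (k₁, k₂) = some s := by
  rcases s with A | ⟨T, u, v⟩
  · simp only [symbols, Finset.inl_mem_disjSum, Finset.mem_filter, Finset.mem_powersetCard,
      Finset.subset_univ, true_and, cell_eq_inl]
    constructor
    · rintro ⟨hA, hd⟩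
      obtain ⟨⟨a, b⟩, h1, h2⟩ := Finset.not_disjoint_iff.1 hd
      obtain rfl : a = k₁ := mem_block.1 h2
      exact ⟨A.erase (a, b), by rw [Finset.card_erase_of_mem h1, hA]; rfl, b,
        Finset.notMem_erase _ _, Finset.insert_erase h1⟩
    · rintro ⟨T, hT, b, hb, rfl⟩
      exact ⟨by rw [Finset.card_insert_of_notMem hb, hT], Finset.not_disjoint_iff.2
        ⟨(k₁, b), Finset.mem_insert_self _ _, mem_block.2 rfl⟩⟩
  · simp only [symbols, Finset.inr_mem_disjSum, Finset.mem_product, Finset.mem_filter,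
      Finset.mem_powersetCard, Finset.subset_univ, true_and, cell_eq_inr, mem_block]
    constructor
    · rintro ⟨⟨hT, hB⟩, rfl⟩
      exact ⟨T, hT, v, hB, rfl⟩
    · rintro ⟨T', hT, b, hB, h⟩
      simp only [Prod.mk.injEq] at h
      obtain ⟨rfl, rfl, rfl⟩ := h
      exact ⟨⟨hT, hB⟩, rfl⟩

lemma mem_mirrorSymbols {t : ℕ} {s : Symb K₁ K₂} :
    s ∈ mirrorSymbols K₁ K₂ t ↔ ∃ T : Finset (Fin K₁ × Fin K₂), T.card = t ∧
      ∃ u : Fin K₁ × Fin K₂, block K₂ u.1 ⊆ T ∧ s = .inr (T, u) := by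
  rcases s with A | ⟨T, u⟩
  · simp [mirrorSymbols]
  · simp only [mirrorSymbols, Finset.inr_mem_disjSum, Finset.mem_filter, Finset.mem_product,
      Finset.mem_powersetCard, Finset.subset_univ, Finset.mem_univ, true_and, and_true]
    constructor
    · rintro ⟨hT, hB⟩
      exact ⟨T, hT, u, hB, rfl⟩
    · rintro ⟨T', hT, u', hB, h⟩
      simp only [Sum.inr.injEq, Prod.mk.injEq] at h
      obtain ⟨rfl, rfl⟩ := h
      exact ⟨hT, hB⟩

lemma card_symbols {t : ℕ} (ht : K₂ ≤ t) (k₁ : Fin K₁) :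
    (symbols (K₂ := K₂) t k₁).card = K₂ * (K₁ * K₂ - K₂).choose (t - K₂)
      + (K₁ * K₂).choose (t + 1) - (K₁ * K₂ - K₂).choose (t + 1) := by
  have h : (K₁ * K₂ - K₂).choose (t + 1) ≤ (K₁ * K₂).choose (t + 1) :=
    Nat.choose_le_choose _ (Nat.sub_le _ _)
  rw [symbols, Finset.card_disjSum, Finset.card_product,
    card_filter_superset_powersetCard _ (by rwa [card_block]),
    card_filter_not_disjoint_powersetCard, card_block, Fintype.card_prod, Fintype.card_fin,
    Fintype.card_fin, Nat.add_sub_assoc h, add_comm, mul_comm K₂ (Nat.choose _ _)]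

lemma mirrorSymbols_subset_biUnion (t : ℕ) :
    mirrorSymbols K₁ K₂ t ⊆ Finset.univ.biUnion (symbols t) := by
  intro s hs
  obtain ⟨T, hT, u, hB, rfl⟩ := mem_mirrorSymbols.1 hs
  exact Finset.mem_biUnion.2 ⟨u.1, Finset.mem_univ _,
    mem_symbols.2 ⟨T, hT, u.2, cell_eq_inr.2 ⟨hB, rfl⟩⟩⟩

lemma biUnion_symbols_sdiff (t : ℕ) :
    Finset.univ.biUnion (symbols t) \ mirrorSymbols K₁ K₂ t =
      (Finset.powersetCard (t + 1) Finset.univ).disjSum ∅ := by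
  ext s
  rcases s with A | ⟨T, u⟩
  · simp only [Finset.mem_sdiff, Finset.mem_biUnion, Finset.mem_univ, true_and, symbols,
      mirrorSymbols, Finset.inl_mem_disjSum, Finset.mem_filter, Finset.mem_powersetCard,
      Finset.subset_univ, Finset.notMem_empty, not_false_eq_true, and_true]
    constructor
    · rintro ⟨_, h, _⟩
      exact h
    · intro h
      obtain ⟨u, hu⟩ := Finset.card_pos.1 (h ▸ Nat.succ_pos t : 0 < A.card)
      exact ⟨u.1, h, Finset.not_disjoint_iff.2 ⟨u, hu, mem_block.2 rfl⟩⟩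
  · simp only [Finset.mem_sdiff, Finset.mem_biUnion, Finset.mem_univ, true_and, symbols,
      mirrorSymbols, Finset.inr_mem_disjSum, Finset.mem_filter, Finset.mem_powersetCard,
      Finset.subset_univ, Finset.notMem_empty, Finset.mem_product, mem_block, and_true,
      iff_false]
    rintro ⟨⟨_, ⟨hT, hB⟩, rfl⟩, h⟩
    exact h ⟨hT, hB⟩

lemma card_filter_cell_eq_none {t : ℕ} (hK₂ : 0 < K₂) (ht : K₂ ≤ t) (u : Fin K₁ × Fin K₂) :
    ((Finset.powersetCard t Finset.univ).filter fun T => cell T u = none).card =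
      (K₁ * K₂ - 1).choose (t - 1) - (K₁ * K₂ - K₂).choose (t - K₂) := by
  have h1 := card_filter_superset_powersetCard {u} (n := t) (by simp; omega)
  have h2 := card_filter_superset_powersetCard (block K₂ u.1) (n := t) (by rwa [card_block])
  simp only [card_block, Finset.card_singleton, Fintype.card_prod, Fintype.card_fin] at h1 h2
  rw [← h1, ← h2, ← Finset.card_sdiff_of_subset]
  · congr 1
    ext T
    simp only [Finset.mem_filter, Finset.mem_sdiff, cell_eq_none, Finset.singleton_subset_iff]
    tauto
  · intro T hT
    rw [Finset.mem_filter] at hT ⊢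
    exact ⟨hT.1, Finset.singleton_subset_iff.2 (hT.2 (mem_block.2 rfl))⟩

end HPDA

lemma Finset.card_filter_equiv_powersetCard {α : Type*} [Fintype α] [DecidableEq α]
    {n m : ℕ} (e : Fin m ≃ {T : Finset α // T.card = n}) (p : Finset α → Prop)
    [DecidablePred p] :
    (univ.filter fun j => p (e j)).card = ((powersetCard n univ).filter p).card := by
  refine card_bij (fun j _ => (e j : Finset α)) ?_ ?_ ?_
  · intro j hj
    simpa [(e j).2] using hj
  · intro i _ j _ h
    exact e.injective (Subtype.ext h)
  · intro T hT
    simp only [mem_filter, mem_powersetCard, subset_univ, true_and] at hT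
    exact ⟨e.symm ⟨T, hT.1⟩, by simpa using hT.2, by simp⟩

/-- **Theorem 2.** For positive integers `K₁, K₂, t` with `K₂ < t < K₁K₂`,
setting `K = K₁K₂`, there exists a
`(K₁, K₂; C(K,t); C(K−K₂,t−K₂), C(K−1,t−1) − C(K−K₂,t−K₂); S_m, S_1, …, S_{K₁})` HPDA with
`S_m ⊆ ⋃ S_{k₁}`, `|⋃ S_{k₁}| − |S_m| = C(K,t+1)`, and
`|S_{k₁}| = K₂·C(K−K₂,t−K₂) + C(K,t+1) − C(K−K₂,t+1)` for every `k₁`. -/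
theorem hpda_from_mn_pda (K₁ K₂ t : ℕ) (hK₁ : 0 < K₁) (hK₂ : 0 < K₂)
    (h₁ : K₂ < t) (h₂ : t < K₁ * K₂) :
    ∃ (Sm : Finset ℕ) (Sk : Fin K₁ → Finset ℕ)
      (P0 : Fin ((K₁ * K₂).choose t) → Fin K₁ → Bool)
      (P : Fin K₁ → Fin ((K₁ * K₂).choose t) → Fin K₂ → Option ℕ),
      IsHPDA K₁ K₂ ((K₁ * K₂).choose t)
        ((K₁ * K₂ - K₂).choose (t - K₂))
        ((K₁ * K₂ - 1).choose (t - 1) - (K₁ * K₂ - K₂).choose (t - K₂))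
        Sm Sk P0 P ∧
      Sm ⊆ Finset.univ.biUnion Sk ∧
      (Finset.univ.biUnion Sk).card - Sm.card = (K₁ * K₂).choose (t + 1) ∧
      (∀ k₁ : Fin K₁, (Sk k₁).card
        = K₂ * (K₁ * K₂ - K₂).choose (t - K₂)
          + (K₁ * K₂).choose (t + 1) - (K₁ * K₂ - K₂).choose (t + 1)) := by
  classical
  obtain ⟨f, hf⟩ := exists_injective_nat (HPDA.Symb K₁ K₂)
  have hF : Fintype.card {T : Finset (Fin K₁ × Fin K₂) // T.card = t} = (K₁ * K₂).choose t := by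
    simp
  let e := (Fintype.equivFinOfCardEq hF).symm
  let enc : HPDA.Symb K₁ K₂ ↪ ℕ := ⟨f, hf⟩
  have hP : ∀ (k₁ : Fin K₁) (j : Fin ((K₁ * K₂).choose t)) (k₂ : Fin K₂) (s : ℕ),
      (HPDA.cell (e j) (k₁, k₂)).map enc = some s ↔
        ∃ a, HPDA.cell (e j) (k₁, k₂) = some a ∧ enc a = s := by
    intro k₁ j k₂ s
    simp [Option.map_eq_some_iff]
  have hmono : (K₁ * K₂ - 1).choose (t - 1) < (K₁ * K₂).choose t := by
    obtain ⟨n, hn⟩ : ∃ n, K₁ * K₂ = n + 1 := ⟨K₁ * K₂ - 1, by omega⟩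
    obtain ⟨r, rfl⟩ : ∃ r, t = r + 1 := ⟨t - 1, by omega⟩
    rw [hn, Nat.choose_succ_succ']
    exact Nat.lt_add_of_pos_right (Nat.choose_pos (by omega))
  have hsub : (K₁ * K₂ - K₂).choose (t - K₂) ≤ (K₁ * K₂ - 1).choose (t - 1) := by
    have h : ∀ d n r : ℕ, n.choose r ≤ (n + d).choose (r + d) := by
      intro d n r
      induction d with
      | zero => rfl
      | succ d ih => exact ih.trans (by
          rw [← add_assoc, ← add_assoc, Nat.choose_succ_succ]; exact Nat.le_add_right _ _)
    have := h (K₂ - 1) (K₁ * K₂ - K₂) (t - K₂)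
    rwa [show K₁ * K₂ - K₂ + (K₂ - 1) = K₁ * K₂ - 1 by omega,
      show t - K₂ + (K₂ - 1) = t - 1 by omega] at this
  have hbi : Finset.univ.biUnion (fun k₁ : Fin K₁ => (HPDA.symbols (K₂ := K₂) t k₁).map enc) =
      (Finset.univ.biUnion (HPDA.symbols t)).map enc := by
    simp only [Finset.map_eq_image, Finset.biUnion_image]
  refine ⟨(HPDA.mirrorSymbols K₁ K₂ t).map enc, fun k₁ => (HPDA.symbols t k₁).map enc,
    fun j k₁ => decide (HPDA.block K₂ k₁ ⊆ e j),
    fun k₁ j k₂ => (HPDA.cell (e j) (k₁, k₂)).map enc,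
    ⟨by omega, by omega, ?_, ?_, ?_, ?_, ?_⟩, ?_, ?_, ?_⟩
  · intro k₁
    simp only [decide_eq_true_eq]
    rw [Finset.card_filter_equiv_powersetCard e (fun T => HPDA.block K₂ k₁ ⊆ T),
      card_filter_superset_powersetCard _ (by rw [HPDA.card_block]; omega), HPDA.card_block]
    simp
  · intro k₁
    refine ⟨?_, ?_, ?_, ?_⟩
    · intro j k₂ s hs
      obtain ⟨a, ha, rfl⟩ := (hP _ _ _ _).1 hs
      exact Finset.mem_map_of_mem _ (HPDA.mem_symbols.2 ⟨e j, (e j).2, k₂, ha⟩)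
    · intro k₂
      simp only [Option.map_eq_none_iff]
      rw [Finset.card_filter_equiv_powersetCard e (fun T => HPDA.cell T (k₁, k₂) = none)]
      exact HPDA.card_filter_cell_eq_none hK₂ h₁.le _
    · intro s hs
      obtain ⟨a, ha, rfl⟩ := Finset.mem_map.1 hs
      obtain ⟨T, hT, k₂, hc⟩ := HPDA.mem_symbols.1 ha
      exact ⟨e.symm ⟨T, hT⟩, k₂, by simp [hc]⟩
    · intro j₁ j₂ k k' s hs hs' hne
      obtain ⟨a, ha, rfl⟩ := (hP _ _ _ _).1 hs
      obtain ⟨b, hb, hab⟩ := (hP _ _ _ _).1 hs'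
      obtain rfl := enc.injective hab
      obtain ⟨hu, hu', hv, hv', hT, huu⟩ := HPDA.mem_of_cell_eq ha hb (by
        intro h
        simp only [Prod.mk.injEq, true_and] at h
        exact hne (Prod.ext (e.injective (Subtype.ext h.1)) h.2))
      simp only [Option.map_eq_none_iff, HPDA.cell_eq_none]
      exact ⟨fun h => hT (by rw [h]), fun h => huu (by rw [h]),
        ⟨hv', fun h => hu (h (HPDA.mem_block.2 rfl))⟩,
        ⟨hv, fun h => hu' (h (HPDA.mem_block.2 rfl))⟩⟩
  · intro s hs
    obtain ⟨a, ha, rfl⟩ := Finset.mem_map.1 hs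
    obtain ⟨T, hT, u, hB, rfl⟩ := HPDA.mem_mirrorSymbols.1 ha
    refine ⟨u.1, ⟨e.symm ⟨T, hT⟩, u.2, ?_⟩, ?_⟩
    · exact (hP _ _ _ _).2 ⟨_, by simpa [HPDA.cell_eq_inr] using hB, rfl⟩
    · rintro k ⟨j, k₂, h⟩
      obtain ⟨b, hb, hab⟩ := (hP _ _ _ _).1 h
      obtain rfl := enc.injective hab
      exact congrArg (fun p => p.2.1) (HPDA.cell_eq_inr.1 hb).2
  · intro k₁ j k₂ s hs hm
    obtain ⟨a, ha, rfl⟩ := (hP _ _ _ _).1 hs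
    obtain ⟨T, hT, u, hB, rfl⟩ := HPDA.mem_mirrorSymbols.1 ((Finset.mem_map' enc).1 hm)
    exact decide_eq_true (HPDA.cell_eq_inr.1 ha).1
  · intro k₁ k₁' j j' k₂ k₂' s hk hs hs'
    obtain ⟨a, ha, rfl⟩ := (hP _ _ _ _).1 hs
    obtain ⟨b, hb, hab⟩ := (hP _ _ _ _).1 hs'
    obtain rfl := enc.injective hab
    obtain ⟨-, -, hv, hv', -, -⟩ := HPDA.mem_of_cell_eq ha hb (fun h => hk (by simp_all))
    constructor
    · rintro ⟨s', h⟩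
      refine decide_eq_true (by_contra fun hB => ?_)
      simp [HPDA.cell_eq_none.2 ⟨hv, hB⟩] at h
    · rintro ⟨s', h⟩
      refine decide_eq_true (by_contra fun hB => ?_)
      simp [HPDA.cell_eq_none.2 ⟨hv', hB⟩] at h
  · rw [hbi]
    exact Finset.map_subset_map.2 (HPDA.mirrorSymbols_subset_biUnion t)
  · rw [hbi, Finset.card_map, Finset.card_map,
      ← Finset.card_sdiff_of_subset (HPDA.mirrorSymbols_subset_biUnion t),
      HPDA.biUnion_symbols_sdiff]
    simp
  · intro k₁
    rw [Finset.card_map, HPDA.card_symbols h₁.le]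
end

section
/- Let A be a (K₁, F₁, Z₁, S₁) PDA and B a (K₂, F₂, Z₂, S₂) PDA. Then there exist finite sets of natural numbers S_m and S_1,…,S_{K₁} and arrays P⁽⁰⁾, P⁽¹⁾,…,P⁽ᴷ¹⁾ forming a (K₁, K₂; F₁F₂; Z₁F₂, Z₂F₁; S_m, S_1,…,S_{K₁}) HPDA, such that moreover S_m ⊆ ⋃_{k₁∈[K₁]} S_{k₁}, |S_m| = K₁·Z₁·S₂, |S_{k₁}| = F₁·S₂ for every k₁ ∈ [K₁], and |⋃_{k₁∈[K₁]} S_{k₁}| − |S_m| = S₁·S₂. -/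
section HybridConstruction

variable {K F K' F' Z Z' : ℕ} {S S' : Finset ℕ}
  {A : Fin F → Fin K → Option ℕ} {B : Fin F' → Fin K' → Option ℕ}

/-- The star count of a nonempty array is smaller than the number of rows. -/
lemma IsPDA.stars_lt (hA : IsPDA K F S Z A) (hS : S.Nonempty) : Z < F := by
  obtain ⟨-, hZ, hocc, -⟩ := hA
  obtain ⟨s, hs⟩ := hS
  obtain ⟨j, k, hjk⟩ := hocc s hs
  rw [← hZ k]
  refine (Finset.card_lt_univ_of_notMem (x := j) ?_).trans_eq (Fintype.card_fin F)
  simp [hjk]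

/-- The positions of the stars of an array. -/
def starPositions (A : Fin F → Fin K → Option ℕ) : Finset (Fin F × Fin K) :=
  Finset.univ.filter fun p => A p.1 p.2 = none

lemma IsPDA.card_starPositions (hA : IsPDA K F S Z A) : (starPositions A).card = K * Z := by
  rw [starPositions, Finset.card_filter, Fintype.sum_prod_type_right]
  simp only [← Finset.card_filter, hA.2.1]
  simp

/-- The label of a cell: its integer, or the position of the cell if it holds a star. -/
def cellLabel (A : Fin F → Fin K → Option ℕ) (i : Fin F) (k : Fin K) : ℕ ⊕ Fin F × Fin K :=
  (A i k).elim (Sum.inr (i, k)) Sum.inl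

lemma cellLabel_eq_inl {i : Fin F} {k : Fin K} {a : ℕ} :
    cellLabel A i k = Sum.inl a ↔ A i k = some a := by
  cases h : A i k <;> simp [cellLabel, h]

lemma cellLabel_eq_inr {i : Fin F} {k : Fin K} {p : Fin F × Fin K} :
    cellLabel A i k = Sum.inr p ↔ A i k = none ∧ (i, k) = p := by
  cases h : A i k <;> simp [cellLabel, h]

/-- Labels within a column are distinct. -/
lemma IsPDA.cellLabel_injective (hA : IsPDA K F S Z A) (k : Fin K) :
    Function.Injective fun i => cellLabel A i k := by
  intro i i' h
  simp only at h
  cases ha : A i k with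
  | none =>
    rw [cellLabel_eq_inr.2 ⟨ha, rfl⟩, eq_comm, cellLabel_eq_inr] at h
    exact (Prod.ext_iff.1 h.2).1.symm
  | some a =>
    rw [cellLabel_eq_inl.2 ha, eq_comm, cellLabel_eq_inl] at h
    by_contra hne
    exact (hA.2.2.2 i i' k k a ha h (by simpa using hne)).2.1 rfl

/-- Cells in distinct columns with equal labels hold equal integers, so the crossing cells
are stars. -/
lemma IsPDA.crossing_of_cellLabel_eq (hA : IsPDA K F S Z A) {i i' : Fin F} {k k' : Fin K}
    (hk : k ≠ k') (h : cellLabel A i k = cellLabel A i' k') :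
    A i k' = none ∧ A i' k = none := by
  cases ha : A i k with
  | none =>
    rw [cellLabel_eq_inr.2 ⟨ha, rfl⟩, eq_comm, cellLabel_eq_inr] at h
    exact absurd (Prod.ext_iff.1 h.2).2.symm hk
  | some a =>
    rw [cellLabel_eq_inl.2 ha, eq_comm, cellLabel_eq_inl] at h
    exact (hA.2.2.2 i i' k k' a ha h (by simp [hk])).2.2

/-- The labels occurring in an array are its integers and its star positions. -/
lemma IsPDA.mem_disjSum_iff (hA : IsPDA K F S Z A) (l : ℕ ⊕ Fin F × Fin K) :
    l ∈ S.disjSum (starPositions A) ↔ ∃ k i, cellLabel A i k = l := by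
  rcases l with a | ⟨i, k⟩
  · simp only [Finset.inl_mem_disjSum, cellLabel_eq_inl]
    exact ⟨fun h => (hA.2.2.1 a h).elim fun i ⟨k, h⟩ => ⟨k, i, h⟩, fun ⟨k, i, h⟩ => hA.1 i k a h⟩
  · simp [starPositions, cellLabel_eq_inr]

/-- The integer that encodes a label of the outer array and an entry of the inner array. -/
def pairCode (p : (ℕ ⊕ Fin F × Fin K) × ℕ) : ℕ := Encodable.encode p

lemma pairCode_injective : Function.Injective (pairCode (F := F) (K := K)) :=
  Encodable.encode_injective

/-- The codes of the pairs with label in `L` and entry in `S`. -/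
def codes (L : Finset (ℕ ⊕ Fin F × Fin K)) (S : Finset ℕ) : Finset ℕ :=
  (L ×ˢ S).image pairCode

lemma card_codes (L : Finset (ℕ ⊕ Fin F × Fin K)) (S : Finset ℕ) :
    (codes L S).card = L.card * S.card := by
  rw [codes, Finset.card_image_of_injective _ pairCode_injective, Finset.card_product]

lemma mem_codes {L : Finset (ℕ ⊕ Fin F × Fin K)} {S : Finset ℕ} {s : ℕ} :
    s ∈ codes L S ↔ ∃ l ∈ L, ∃ b ∈ S, pairCode (l, b) = s := by
  simp [codes, and_assoc]

lemma pairCode_mem_codes {L : Finset (ℕ ⊕ Fin F × Fin K)} {S : Finset ℕ}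
    {l : ℕ ⊕ Fin F × Fin K} {b : ℕ} : pairCode (l, b) ∈ codes L S ↔ l ∈ L ∧ b ∈ S := by
  rw [codes, pairCode_injective.mem_finset_image, Finset.mem_product]

/-- The labels in column `k`. -/
def columnLabels (A : Fin F → Fin K → Option ℕ) (k : Fin K) : Finset (ℕ ⊕ Fin F × Fin K) :=
  Finset.univ.image fun i => cellLabel A i k

/-- The array of the users attached to mirror `k`: a copy of `B` for each row `i` of `A`, whose
integers are tagged with the label of the cell `(i, k)` of `A`. -/
def userArray (A : Fin F → Fin K → Option ℕ) (B : Fin F' → Fin K' → Option ℕ) (k : Fin K)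
    (j : Fin (F * F')) (k' : Fin K') : Option ℕ :=
  (B j.modNat k').map fun b => pairCode (cellLabel A j.divNat k, b)

/-- The mirror array: each row of the star pattern of `A` repeated `F'` times. -/
def mirrorArray (F' : ℕ) (A : Fin F → Fin K → Option ℕ) (j : Fin (F * F')) (k : Fin K) : Bool :=
  (A j.divNat k).isNone

lemma userArray_eq_some {k : Fin K} {j : Fin (F * F')} {k' : Fin K'} {s : ℕ} :
    userArray A B k j k' = some s ↔
      ∃ b, B j.modNat k' = some b ∧ pairCode (cellLabel A j.divNat k, b) = s := by
  simp [userArray]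

lemma userArray_eq_none {k : Fin K} {j : Fin (F * F')} {k' : Fin K'} :
    userArray A B k j k' = none ↔ B j.modNat k' = none := by
  simp [userArray]

lemma userArray_finProdFinEquiv (k : Fin K) (i : Fin F) (i' : Fin F') (k' : Fin K') :
    userArray A B k (finProdFinEquiv (i, i')) k' =
      (B i' k').map fun b => pairCode (cellLabel A i k, b) := by
  have h := finProdFinEquiv.symm_apply_apply (i, i')
  rw [finProdFinEquiv_symm_apply, Prod.ext_iff] at h
  simp only at h
  rw [userArray, h.1, h.2]

lemma card_filter_divNat_modNat (p : Fin F → Prop) (q : Fin F' → Prop) [DecidablePred p]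
    [DecidablePred q] :
    (Finset.univ.filter fun j : Fin (F * F') => p j.divNat ∧ q j.modNat).card =
      (Finset.univ.filter p).card * (Finset.univ.filter q).card := by
  rw [← Finset.card_product]
  refine Finset.card_equiv finProdFinEquiv.symm fun j => ?_
  simp

lemma IsPDA.card_mirrorArray (hA : IsPDA K F S Z A) (F' : ℕ) (k : Fin K) :
    (Finset.univ.filter fun j => mirrorArray F' A j k = true).card = Z * F' := by
  have h := card_filter_divNat_modNat (fun i => A i k = none) fun _ : Fin F' => True
  simpa [mirrorArray, hA.2.1 k] using h

lemma IsPDA.userArray (hA : IsPDA K F S Z A) (hB : IsPDA K' F' S' Z' B) (k : Fin K) :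
    IsPDA K' (F * F') (codes (columnLabels A k) S') (Z' * F) (userArray A B k) := by
  refine ⟨?_, ?_, ?_, ?_⟩
  · intro j k' s h
    obtain ⟨b, hb, rfl⟩ := userArray_eq_some.1 h
    exact pairCode_mem_codes.2 ⟨by simp [columnLabels], hB.1 _ _ _ hb⟩
  · intro k'
    have h := card_filter_divNat_modNat (fun _ : Fin F => True) fun i' => B i' k' = none
    simpa [userArray_eq_none, hB.2.1 k', mul_comm] using h
  · intro s hs
    obtain ⟨l, hl, b, hb, rfl⟩ := mem_codes.1 hs
    obtain ⟨i, -, rfl⟩ := Finset.mem_image.1 hl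
    obtain ⟨i', k', h⟩ := hB.2.2.1 b hb
    exact ⟨finProdFinEquiv (i, i'), k', by simp [userArray_finProdFinEquiv, h]⟩
  · intro j₁ j₂ k₁ k₂ s h₁ h₂ hne
    obtain ⟨b, hb₁, rfl⟩ := userArray_eq_some.1 h₁
    obtain ⟨b', hb₂, h⟩ := userArray_eq_some.1 h₂
    obtain ⟨hl, rfl⟩ := Prod.ext_iff.1 (pairCode_injective h)
    have hdiv : j₂.divNat = j₁.divNat := hA.cellLabel_injective k hl
    have hne' : (j₁.modNat, k₁) ≠ (j₂.modNat, k₂) := by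
      intro heq
      obtain ⟨hmod, rfl⟩ := Prod.ext_iff.1 heq
      exact hne (Prod.ext (finProdFinEquiv.symm.injective (Prod.ext hdiv.symm hmod)) rfl)
    obtain ⟨hj, hk, h₁₂, h₂₁⟩ := hB.2.2.2 _ _ _ _ _ hb₁ hb₂ hne'
    exact ⟨fun h => hj (by rw [h]), hk, userArray_eq_none.2 h₁₂, userArray_eq_none.2 h₂₁⟩

/-- The codes of the integers that are only sent by a mirror. -/
def mirrorCodes (A : Fin F → Fin K → Option ℕ) (S' : Finset ℕ) : Finset ℕ :=
  codes ((∅ : Finset ℕ).disjSum (starPositions A)) S'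

lemma mem_mirrorCodes {s : ℕ} :
    s ∈ mirrorCodes A S' ↔
      ∃ i k, A i k = none ∧ ∃ b ∈ S', pairCode (Sum.inr (i, k), b) = s := by
  simp [mirrorCodes, mem_codes, starPositions]

lemma IsPDA.isHPDA (hA : IsPDA K F S Z A) (hB : IsPDA K' F' S' Z' B) (hS : S.Nonempty)
    (hS' : S'.Nonempty) :
    IsHPDA K K' (F * F') (Z * F') (Z' * F) (mirrorCodes A S')
      (fun k => codes (columnLabels A k) S') (mirrorArray F' A) (_root_.userArray A B) := by
  have hZ := hA.stars_lt hS
  have hZ' := hB.stars_lt hS'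
  refine ⟨Nat.mul_lt_mul_of_pos_right hZ (by lia), ?_, hA.card_mirrorArray F',
    hA.userArray hB, ?_, ?_, ?_⟩
  · rw [mul_comm F]
    exact Nat.mul_lt_mul_of_pos_right hZ' (by lia)
  · intro s hs
    obtain ⟨i, k, hik, b, hb, rfl⟩ := mem_mirrorCodes.1 hs
    obtain ⟨i', k', h⟩ := hB.2.2.1 b hb
    refine ⟨k, ⟨finProdFinEquiv (i, i'), k', ?_⟩, ?_⟩
    · simp [userArray_finProdFinEquiv, h, cellLabel_eq_inr.2 ⟨hik, rfl⟩]
    · rintro k₁ ⟨j, k₂, hj⟩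
      obtain ⟨b', -, h'⟩ := userArray_eq_some.1 hj
      have hl := (cellLabel_eq_inr.1 (Prod.ext_iff.1 (pairCode_injective h')).1).2
      exact (Prod.ext_iff.1 hl).2
  · intro k j k' s h hs
    obtain ⟨i, k₁, -, b, -, rfl⟩ := mem_mirrorCodes.1 hs
    obtain ⟨b', -, h'⟩ := userArray_eq_some.1 h
    have hl := (cellLabel_eq_inr.1 (Prod.ext_iff.1 (pairCode_injective h')).1).1
    simp [mirrorArray, hl]
  · intro k₁ k₁' j j' k₂ k₂' s hk h h'
    obtain ⟨b, -, rfl⟩ := userArray_eq_some.1 h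
    obtain ⟨b', -, hcode⟩ := userArray_eq_some.1 h'
    have hl := (Prod.ext_iff.1 (pairCode_injective hcode)).1.symm
    obtain ⟨h₁, h₂⟩ := hA.crossing_of_cellLabel_eq hk hl
    exact ⟨fun _ => by simp [mirrorArray, h₂], fun _ => by simp [mirrorArray, h₁]⟩

lemma IsPDA.biUnion_codes_columnLabels (hA : IsPDA K F S Z A) (S' : Finset ℕ) :
    (Finset.univ.biUnion fun k => codes (columnLabels A k) S') =
      codes (S.disjSum (starPositions A)) S' := by
  ext s
  simp only [Finset.mem_biUnion, Finset.mem_univ, true_and, mem_codes, hA.mem_disjSum_iff,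
    columnLabels, Finset.mem_image]
  exact ⟨fun ⟨k, l, ⟨i, h⟩, hs⟩ => ⟨l, ⟨k, i, h⟩, hs⟩, fun ⟨l, ⟨k, i, h⟩, hs⟩ => ⟨k, l, ⟨i, h⟩, hs⟩⟩

end HybridConstruction

/-- **Theorem 3.** Given a `(K₁,F₁,Z₁,S₁)` PDA `A` and a `(K₂,F₂,Z₂,S₂)`
PDA `B` (with integer alphabets `[S₁]` and `[S₂]`), there exists a
`(K₁, K₂; F₁F₂; Z₁F₂, Z₂F₁; S_m, S_1, …, S_{K₁})` HPDA with `S_m ⊆ ⋃ S_{k₁}`,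
`|S_m| = K₁·Z₁·S₂`, `|S_{k₁}| = F₁·S₂` for every `k₁`, and `|⋃ S_{k₁}| − |S_m| = S₁·S₂`. -/
theorem hpda_hybrid_construction (K₁ F₁ Z₁ S₁ K₂ F₂ Z₂ S₂ : ℕ)
    (hK₁ : 0 < K₁) (hF₁ : 0 < F₁) (hZ₁ : 0 < Z₁) (hS₁ : 0 < S₁)
    (hK₂ : 0 < K₂) (hF₂ : 0 < F₂) (hZ₂ : 0 < Z₂) (hS₂ : 0 < S₂)
    (A : Fin F₁ → Fin K₁ → Option ℕ) (hA : IsPDA K₁ F₁ (Finset.Icc 1 S₁) Z₁ A)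
    (B : Fin F₂ → Fin K₂ → Option ℕ) (hB : IsPDA K₂ F₂ (Finset.Icc 1 S₂) Z₂ B) :
    ∃ (Sm : Finset ℕ) (Sk : Fin K₁ → Finset ℕ)
      (P0 : Fin (F₁ * F₂) → Fin K₁ → Bool)
      (P : Fin K₁ → Fin (F₁ * F₂) → Fin K₂ → Option ℕ),
      IsHPDA K₁ K₂ (F₁ * F₂) (Z₁ * F₂) (Z₂ * F₁) Sm Sk P0 P ∧
      Sm ⊆ Finset.univ.biUnion Sk ∧
      Sm.card = K₁ * Z₁ * S₂ ∧
      (∀ k₁ : Fin K₁, (Sk k₁).card = F₁ * S₂) ∧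
      (Finset.univ.biUnion Sk).card - Sm.card = S₁ * S₂ := by
  have hSm : (mirrorCodes A (Finset.Icc 1 S₂)).card = K₁ * Z₁ * S₂ := by
    simp [mirrorCodes, card_codes, hA.card_starPositions]
  refine ⟨mirrorCodes A (Finset.Icc 1 S₂), fun k => codes (columnLabels A k) (Finset.Icc 1 S₂),
    mirrorArray F₂ A, userArray A B,
    hA.isHPDA hB (Finset.nonempty_Icc.2 hS₁) (Finset.nonempty_Icc.2 hS₂), ?_, hSm, ?_, ?_⟩
  · rw [hA.biUnion_codes_columnLabels]
    exact Finset.image_subset_image (Finset.product_subset_product_left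
      (Finset.disjSum_mono (Finset.empty_subset _) subset_rfl))
  · intro k
    rw [card_codes, columnLabels, Finset.card_image_of_injective _ (hA.cellLabel_injective k)]
    simp
  · rw [hA.biUnion_codes_columnLabels, hSm, card_codes, Finset.card_disjSum,
      hA.card_starPositions, add_mul]
    simp
end
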